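/- Consider the inverse-problem setting with exact coefficient c satisfying c(x) ≥ 0 on Ω and f satisfying condition (7), and the iterative process started from the initial approximation (16), with sufficiently smooth iterates u^k and coefficients c^k. Then for every k ≥ 1, w^k = u^k − u^{k−1} satisfies w^k(x,t) ≥ 0 for all x ∈ Ω, 0 < t ≤ T, and ξ^k = c^k − c^{k−1} satisfies ξ^k(x) ≤ 0 for all x ∈ Ω. -/

import Mathlib

noncomputable section

/-- The plane `ℝ²`. -/
abbrev E2 : Type := EuclideanSpace ℝ (Fin 2)

/-- The elliptic operator `(A v)(x) = - div (k(x) grad v(x))`. -/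
def ellOp (k : E2 → ℝ) (v : E2 → ℝ) (x : E2) : ℝ :=
  - ∑ i : Fin 2, fderiv ℝ (fun y => k y • gradient v y) x (EuclideanSpace.single i 1) i

/-- `u` solves the direct problem on `Ω × (0,T]` with diffusion coefficient `k`,
Robin boundary coefficient `μ`, reaction coefficient `c` and right-hand side `f`:
the parabolic equation, the homogeneous initial condition and the homogeneous
Robin (third-kind) boundary condition with respect to any outward unit normal. -/
structure IsDirectSolution (Ω : Set E2) (T : ℝ) (k μ : E2 → ℝ)
    (c : E2 → ℝ) (f : E2 → ℝ → ℝ) (u : E2 → ℝ → ℝ) : Prop where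
  pde : ∀ x ∈ Ω, ∀ t : ℝ, 0 < t → t ≤ T →
    deriv (u x) t + ellOp k (fun y => u y t) x + c x * u x t = f x t
  ic : ∀ x ∈ Ω, u x 0 = 0
  robin : ∀ x ∈ frontier Ω, ∀ ν : E2, ‖ν‖ = 1 →
    (∀ y ∈ closure Ω, (inner ℝ ν (y - x) : ℝ) ≤ 0) →
    ∀ t : ℝ, 0 < t → t ≤ T →
      k x * fderiv ℝ (fun y => u y t) x ν + μ x * u x t = 0

def DD {E : Type*} [NormedAddCommGroup E] [NormedSpace ℝ E] (a : E) (F : E → ℝ) : E → ℝ :=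
  fun z => fderiv ℝ F z a

section
variable {E : Type*} [NormedAddCommGroup E] [NormedSpace ℝ E]

lemma DD_smooth (a : E) {F : E → ℝ} (hF : ContDiff ℝ (⊤ : ℕ∞) F) :
    ContDiff ℝ (⊤ : ℕ∞) (DD a F) := by
  unfold DD
  have h : ContDiff ℝ (⊤ : ℕ∞) (fderiv ℝ F) := hF.fderiv_right (by simp)
  exact h.clm_apply contDiff_const

lemma smooth_diff {F : E → ℝ} (hF : ContDiff ℝ (⊤ : ℕ∞) F) : Differentiable ℝ F :=
  hF.differentiable (by simp)

lemma DD_DD (a b : E) {F : E → ℝ} (hF : ContDiff ℝ (⊤ : ℕ∞) F) (z : E) :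
    DD a (DD b F) z = fderiv ℝ (fderiv ℝ F) z a b := by
  have h : ContDiff ℝ (⊤ : ℕ∞) (fderiv ℝ F) := hF.fderiv_right (by simp)
  have h1 : DifferentiableAt ℝ (fderiv ℝ F) z := (h.differentiable (by simp)) z
  unfold DD
  rw [fderiv_clm_apply h1 (differentiableAt_const b)]
  simp

lemma DD_comm (a b : E) {F : E → ℝ} (hF : ContDiff ℝ (⊤ : ℕ∞) F) :
    DD a (DD b F) = DD b (DD a F) := by
  funext z
  rw [DD_DD a b hF, DD_DD b a hF]
  have := (hF.contDiffAt (x := z)).isSymmSndFDerivAt (n := (⊤ : ℕ∞)) (by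
    rw [minSmoothness_of_isRCLikeNormedField]; exact WithTop.coe_le_coe.2 (le_top (a := (2 : ℕ∞))))
  exact this a b

lemma DD_add (a : E) {F G : E → ℝ} (hF : ContDiff ℝ (⊤ : ℕ∞) F) (hG : ContDiff ℝ (⊤ : ℕ∞) G) :
    DD a (fun z => F z + G z) = fun z => DD a F z + DD a G z := by
  funext z
  unfold DD
  rw [fderiv_fun_add (smooth_diff hF z) (smooth_diff hG z)]; rfl

lemma DD_sub (a : E) {F G : E → ℝ} (hF : ContDiff ℝ (⊤ : ℕ∞) F) (hG : ContDiff ℝ (⊤ : ℕ∞) G) :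
    DD a (fun z => F z - G z) = fun z => DD a F z - DD a G z := by
  funext z
  unfold DD
  rw [fderiv_fun_sub (smooth_diff hF z) (smooth_diff hG z)]; rfl

/-- derivative along a line -/
lemma DD_line (a : E) {F : E → ℝ} (hF : ContDiff ℝ (⊤ : ℕ∞) F) (z : E) (s : ℝ) :
    HasDerivAt (fun s : ℝ => F (z + s • a)) (DD a F (z + s • a)) s := by
  have h1 : HasDerivAt (fun s : ℝ => z + s • a) a s := by
    simpa using ((hasDerivAt_id s).smul_const a).const_add z
  exact ((smooth_diff hF _).hasFDerivAt).comp_hasDerivAt s h1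

/-- second derivative test -/
lemma second_nonneg (a : E) {F : E → ℝ} (hF : ContDiff ℝ (⊤ : ℕ∞) F) (z : E)
    (hmin : IsLocalMin (fun s : ℝ => F (z + s • a)) 0) : 0 ≤ DD a (DD a F) z := by
  by_contra hneg
  push Not at hneg
  have hd : deriv (fun s : ℝ => F (z + s • a)) = fun s => DD a F (z + s • a) := by
    funext s; exact (DD_line a hF z s).deriv
  have hd2 : deriv (deriv (fun s : ℝ => F (z + s • a))) 0 = DD a (DD a F) z := by
    rw [hd]; simpa using (DD_line a (DD_smooth a hF) z 0).deriv
  have hd1 := hmin.deriv_eq_zero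
  have hmax := isLocalMax_of_deriv_deriv_neg (by rw [hd2]; exact hneg) hd1
    (DD_line a hF z 0).continuousAt
  have heq : (fun s : ℝ => F (z + s • a)) =ᶠ[nhds 0] fun _ => F (z + (0:ℝ) • a) := by
    filter_upwards [hmin, hmax] with s h1 h2
    exact le_antisymm h2 h1
  have := heq.deriv.deriv_eq
  rw [hd2] at this
  simp at this
  linarith
end

abbrev ee (i : Fin 2) : E2 × ℝ := (EuclideanSpace.single i 1, 0)
abbrev tt : E2 × ℝ := (0, 1)

def LL (k : E2 → ℝ) (F : E2 × ℝ → ℝ) (z : E2 × ℝ) : ℝ :=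
  ∑ i : Fin 2, (k z.1 * DD (ee i) (DD (ee i) F) z
    + fderiv ℝ k z.1 (EuclideanSpace.single i 1) * DD (ee i) F z)

lemma DD_space {F : E2 × ℝ → ℝ} (hF : ContDiff ℝ (⊤ : ℕ∞) F) (x : E2) (t : ℝ) (e : E2) :
    fderiv ℝ (fun y => F (y, t)) x e = DD (e, (0:ℝ)) F (x, t) := by
  have h1 : HasFDerivAt (fun y : E2 => (y, t)) (ContinuousLinearMap.inl ℝ E2 ℝ) x := by
    exact hasFDerivAt_prodMk_left x t
  have := ((smooth_diff hF (x,t)).hasFDerivAt).comp x h1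
  have h2 := this.fderiv
  unfold DD
  change fderiv ℝ (F ∘ fun y => (y, t)) x e = _
  rw [h2]; simp

lemma DD_time {F : E2 × ℝ → ℝ} (hF : ContDiff ℝ (⊤ : ℕ∞) F) (x : E2) (t : ℝ) :
    HasDerivAt (fun s => F (x, s)) (DD tt F (x, t)) t := by
  have h1 : HasDerivAt (fun s : ℝ => (x, s)) tt t :=
    (hasDerivAt_const t x).prodMk (hasDerivAt_id t)
  exact ((smooth_diff hF (x,t)).hasFDerivAt).comp_hasDerivAt t h1

lemma ellOp_eq {k : E2 → ℝ} {F : E2 × ℝ → ℝ} (hF : ContDiff ℝ (⊤ : ℕ∞) F) (x : E2) (t : ℝ)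
    (hk : DifferentiableAt ℝ k x) :
    ellOp k (fun y => F (y, t)) x = - LL k F (x, t) := by
  unfold ellOp LL
  congr 1
  refine Finset.sum_congr rfl fun i _ => ?_
  set v : E2 → ℝ := fun y => F (y, t) with hv
  have hvs : ContDiff ℝ (⊤ : ℕ∞) v := hF.comp (contDiff_id.prodMk contDiff_const)
  have hg : ContDiff ℝ (⊤ : ℕ∞) (gradient v) := by
    have h : ContDiff ℝ (⊤ : ℕ∞) (fderiv ℝ v) := hvs.fderiv_right (by simp)
    exact (InnerProductSpace.toDual ℝ E2).symm.contDiff.comp h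
  have hgi : ∀ y, gradient v y i = DD (ee i) F (y, t) := by
    intro y
    rw [← DD_space hF, ← hv]
    have : inner ℝ (gradient v y) (EuclideanSpace.single i (1:ℝ)) = fderiv ℝ v y (EuclideanSpace.single i (1:ℝ)) := by
      simp [gradient]
    rw [← this, EuclideanSpace.inner_single_right]
    simp
  have hd : DifferentiableAt ℝ (fun y => k y • gradient v y) x :=
    hk.smul (hg.differentiable (by simp) x)
  have h1 : fderiv ℝ (fun y => k y • gradient v y) x (EuclideanSpace.single i 1) i
      = fderiv ℝ (fun y => k y * DD (ee i) F (y, t)) x (EuclideanSpace.single i 1) := by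
    have h2 := ((EuclideanSpace.proj i : E2 →L[ℝ] ℝ).hasFDerivAt).comp x hd.hasFDerivAt
    have h3 : (⇑(EuclideanSpace.proj i : E2 →L[ℝ] ℝ) ∘ fun y => k y • gradient v y)
       = (fun y => k y * DD (ee i) F (y, t)) := by
      funext y; simp [← hgi]
    rw [h3] at h2
    rw [h2.fderiv]; simp
  have hs := DD_smooth (ee i) hF
  have hs' : ContDiff ℝ (⊤ : ℕ∞) (fun y => DD (ee i) F (y, t)) := hs.comp (contDiff_id.prodMk contDiff_const)
  rw [h1, fderiv_fun_mul hk (smooth_diff hs' x)]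
  simp only [add_apply, smul_apply, smul_eq_mul]
  rw [DD_space hs]
  ring

lemma LL_add {k : E2 → ℝ} {F G : E2 × ℝ → ℝ} (hF : ContDiff ℝ (⊤ : ℕ∞) F)
    (hG : ContDiff ℝ (⊤ : ℕ∞) G) (z) : LL k (fun z => F z + G z) z = LL k F z + LL k G z := by
  unfold LL
  rw [← Finset.sum_add_distrib]
  refine Finset.sum_congr rfl fun i _ => ?_
  rw [DD_add _ hF hG, DD_add _ (DD_smooth _ hF) (DD_smooth _ hG)]; ring

lemma LL_sub {k : E2 → ℝ} {F G : E2 × ℝ → ℝ} (hF : ContDiff ℝ (⊤ : ℕ∞) F)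
    (hG : ContDiff ℝ (⊤ : ℕ∞) G) (z) : LL k (fun z => F z - G z) z = LL k F z - LL k G z := by
  unfold LL
  rw [← Finset.sum_sub_distrib]
  refine Finset.sum_congr rfl fun i _ => ?_
  rw [DD_sub _ hF hG, DD_sub _ (DD_smooth _ hF) (DD_smooth _ hG)]; ring

lemma LL_time {k : E2 → ℝ} {F : E2 × ℝ → ℝ} (hF : ContDiff ℝ (⊤ : ℕ∞) F) (x : E2) (t : ℝ) :
    HasDerivAt (fun s => LL k F (x, s)) (LL k (DD tt F) (x, t)) t := by
  unfold LL
  have : ∀ i, HasDerivAt (fun s => k x * DD (ee i) (DD (ee i) F) (x,s)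
    + fderiv ℝ k x (EuclideanSpace.single i 1) * DD (ee i) F (x,s)) (k x * DD (ee i) (DD (ee i) (DD tt F)) (x,t)
    + fderiv ℝ k x (EuclideanSpace.single i 1) * DD (ee i) (DD tt F) (x,t)) t := by
    intro i
    have hs := DD_smooth (ee i) hF
    rw [DD_comm (ee i) tt hF, DD_comm (ee i) tt hs]
    exact ((DD_time (DD_smooth _ hs) x t).const_mul _).add ((DD_time hs x t).const_mul _)
  exact HasDerivAt.fun_sum fun i _ => this i

def BB (l : ℝ) (x0 : E2) (z : E2 × ℝ) : ℝ := Real.exp (l * z.2) * (1 + ‖z.1 - x0‖ ^ 2 / 2)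

lemma BB_smooth (l : ℝ) (x0 : E2) : ContDiff ℝ (⊤ : ℕ∞) (BB l x0) := by
  unfold BB
  have h : ContDiff ℝ (⊤ : ℕ∞) (fun z : E2 × ℝ => ‖z.1 - x0‖ ^ 2) :=
    (contDiff_fst.sub contDiff_const).norm_sq ℝ
  exact (Real.contDiff_exp.comp (contDiff_const.mul contDiff_snd)).mul
    (contDiff_const.add (h.div_const 2))

lemma DD_eq_of_line {E : Type*} [NormedAddCommGroup E] [NormedSpace ℝ E] (a : E) {F : E → ℝ}
    (hF : ContDiff ℝ (⊤ : ℕ∞) F) (z : E) (d : ℝ)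
    (h : HasDerivAt (fun s : ℝ => F (z + s • a)) d 0) : DD a F z = d := by
  have := (DD_line a hF z 0).unique h
  simpa using this

lemma BB_time (l : ℝ) (x0 : E2) (z : E2 × ℝ) : DD tt (BB l x0) z = l * BB l x0 z := by
  have h1 := DD_time (BB_smooth l x0) z.1 z.2
  refine h1.unique ?_
  unfold BB
  have := ((((hasDerivAt_id z.2).const_mul l).exp).mul_const (1 + ‖z.1 - x0‖ ^ 2 / 2))
  refine this.congr_deriv ?_
  simp; ring

lemma BB_space (l : ℝ) (x0 e : E2) : DD (e, (0:ℝ)) (BB l x0) =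
    fun z => Real.exp (l * z.2) * inner ℝ e (z.1 - x0) := by
  funext z
  refine DD_eq_of_line _ (BB_smooth l x0) z _ ?_
  have h : (fun s : ℝ => BB l x0 (z + s • (e, (0:ℝ)))) = fun s : ℝ =>
      Real.exp (l * z.2) * (1 + (‖z.1 - x0‖ ^ 2 + 2 * (s * inner ℝ e (z.1 - x0)) + s ^ 2 * ‖e‖ ^ 2) / 2) := by
    funext s
    unfold BB
    have : (z + s • (e, (0:ℝ))).1 - x0 = (z.1 - x0) + s • e := by simp; abel
    rw [this, norm_add_sq_real, real_inner_smul_right, norm_smul, real_inner_comm e]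
    simp [mul_pow]
  rw [h]
  have h0 := hasDerivAt_id (0:ℝ)
  have := (((((h0.mul_const (inner ℝ e (z.1 - x0))).const_mul 2).const_add (‖z.1 - x0‖ ^ 2)).add
    ((h0.pow 2).mul_const (‖e‖ ^ 2))).div_const 2).const_add 1 |>.const_mul (Real.exp (l * z.2))
  refine this.congr_deriv ?_
  simp

lemma BB_space2 (l : ℝ) (x0 e : E2) (z : E2 × ℝ) : DD (e, (0:ℝ)) (DD (e, (0:ℝ)) (BB l x0)) z =
    Real.exp (l * z.2) * ‖e‖ ^ 2 := by
  refine DD_eq_of_line _ (DD_smooth _ (BB_smooth l x0)) z _ ?_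
  rw [BB_space]
  have h : (fun s : ℝ => Real.exp (l * (z + s • (e, (0:ℝ))).2) * inner ℝ e ((z + s • (e, (0:ℝ))).1 - x0)) = fun s : ℝ =>
      Real.exp (l * z.2) * (inner ℝ e (z.1 - x0) + s * ‖e‖ ^ 2) := by
    funext s
    have : (z + s • (e, (0:ℝ))).1 - x0 = (z.1 - x0) + s • e := by simp; abel
    rw [this, inner_add_right, real_inner_smul_right, real_inner_self_eq_norm_sq]
    simp
  rw [h]
  have := (((hasDerivAt_id (0:ℝ)).mul_const (‖e‖ ^ 2)).const_add (inner ℝ e (z.1 - x0))).const_mul (Real.exp (l * z.2))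
  refine this.congr_deriv ?_
  simp

lemma LL_BB (k : E2 → ℝ) (l : ℝ) (x0 : E2) (z : E2 × ℝ) : LL k (BB l x0) z =
    Real.exp (l * z.2) * (2 * k z.1 + fderiv ℝ k z.1 (z.1 - x0)) := by
  unfold LL
  have hx : z.1 - x0 = ∑ i : Fin 2, (z.1 - x0) i • EuclideanSpace.single i (1:ℝ) := by
    ext j; fin_cases j <;> simp
  have h2 : fderiv ℝ k z.1 (z.1 - x0) = ∑ i : Fin 2, (z.1 - x0) i * fderiv ℝ k z.1 (EuclideanSpace.single i (1:ℝ)) := by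
    conv_lhs => rw [hx]
    rw [map_sum]; simp
  rw [h2]
  simp only [BB_space2]
  simp only [BB_space, EuclideanSpace.inner_single_left, Fin.sum_univ_two]
  simp
  ring

lemma first_order {S : Set (E2 × ℝ)} (hS : Convex ℝ S) {q : E2 × ℝ → ℝ}
    (hq : ContDiff ℝ (⊤ : ℕ∞) q) {z : E2 × ℝ} (hz : z ∈ S) (hmin : IsMinOn q S z)
    {y : E2 × ℝ} (hy : y ∈ S) : 0 ≤ DD (y - z) q z := by
  exact hmin.localize.hasFDerivWithinAt_nonneg (smooth_diff hq z).hasFDerivAt.hasFDerivWithinAt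
    (sub_mem_posTangentConeAt_of_segment_subset (hS.segment_subset hz hy))

lemma exists_normal {Ω : Set E2} (hΩo : IsOpen Ω) (hΩconv : Convex ℝ Ω) (hne : Ω.Nonempty) {x : E2}
    (hx : x ∉ Ω) : ∃ ν : E2, ‖ν‖ = 1 ∧ ∀ y ∈ closure Ω, (inner ℝ ν (y - x) : ℝ) ≤ 0 := by
  obtain ⟨φ, hφ⟩ := geometric_hahn_banach_open_point hΩconv hΩo hx
  set v := (InnerProductSpace.toDual ℝ E2).symm φ with hv
  have hvi : ∀ y, inner ℝ v y = φ y := fun y => by simp [hv]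
  have hv0 : v ≠ 0 := by
    intro h
    obtain ⟨y, hy⟩ := hne
    have h1 := hφ y hy
    rw [← hvi, ← hvi, h] at h1
    simp at h1
  refine ⟨‖v‖⁻¹ • v, by rw [norm_smul]; simp [hv0], ?_⟩
  have hcl : closure Ω ⊆ {y | inner ℝ (‖v‖⁻¹ • v) (y - x) ≤ 0} := by
    refine closure_minimal ?_ (isClosed_le (by fun_prop) continuous_const)
    intro y hy
    simp only [Set.mem_ofPred_eq]
    rw [real_inner_smul_left, hvi, map_sub]
    exact mul_nonpos_of_nonneg_of_nonpos (by positivity) (by linarith [hφ y hy])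
  exact fun y hy => hcl hy

lemma normal_pos {Ω : Set E2} (hΩo : IsOpen Ω) {x0 : E2} (hx0 : x0 ∈ Ω) {x ν : E2} (hν : ‖ν‖ = 1)
    (h : ∀ y ∈ closure Ω, (inner ℝ ν (y - x) : ℝ) ≤ 0) : 0 < (inner ℝ ν (x - x0) : ℝ) := by
  obtain ⟨r, hr, hball⟩ := Metric.isOpen_iff.1 hΩo x0 hx0
  have h1 : x0 + (r/2) • ν ∈ Ω := hball (by
    rw [Metric.mem_ball, dist_eq_norm]; simp [norm_smul, hν, abs_of_pos hr]; linarith)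
  have h2 := h _ (subset_closure h1)
  have : x0 + (r/2) • ν - x = (r/2) • ν - (x - x0) := by abel
  rw [this, inner_sub_right, real_inner_smul_right, real_inner_self_eq_norm_sq, hν] at h2
  linarith

lemma div_bound {Ω : Set E2} (hΩo : IsOpen Ω) (hΩb : Bornology.IsBounded Ω) (hΩconv : Convex ℝ Ω)
    {k : E2 → ℝ} (hkC1 : ContDiffOn ℝ 1 k (closure Ω)) {x0 : E2} (hx0 : x0 ∈ Ω) :
    ∃ M : ℝ, 0 ≤ M ∧ ∀ x ∈ Ω, 2 * k x + fderiv ℝ k x (x - x0) ≤ M := by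
  have hcomp : IsCompact (closure Ω) := hΩb.isCompact_closure
  have hud : UniqueDiffOn ℝ (closure Ω) := uniqueDiffOn_convex hΩconv.closure
    ⟨x0, interior_mono subset_closure (by rwa [hΩo.interior_eq])⟩
  have hc : ContinuousOn (fun x => 2 * k x + fderivWithin ℝ k (closure Ω) x (x - x0)) (closure Ω) := by
    refine (continuousOn_const.mul hkC1.continuousOn).add ?_
    exact (hkC1.continuousOn_fderivWithin hud le_rfl).clm_apply (by fun_prop)
  obtain ⟨M, hM⟩ := hcomp.bddAbove_image hc
  refine ⟨max M 0, le_max_right _ _, fun x hx => le_trans ?_ (le_max_left _ _)⟩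
  have := hM ⟨x, subset_closure hx, rfl⟩
  simp only at this
  rwa [fderivWithin_of_mem_nhds (Filter.mem_of_superset (hΩo.mem_nhds hx) subset_closure)] at this

lemma min_principle {Ω : Set E2} (hΩo : IsOpen Ω) (hΩb : Bornology.IsBounded Ω)
    (hΩconv : Convex ℝ Ω) {T : ℝ} (hT : 0 < T) {k μ : E2 → ℝ} {k₁ : ℝ} (hk₁ : 0 < k₁)
    (hkbd : ∀ x ∈ closure Ω, k₁ ≤ k x)
    (hkC1 : ContDiffOn ℝ 1 k (closure Ω))
    (hμ : ∀ x ∈ frontier Ω, 0 ≤ μ x)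
    {c : E2 → ℝ} (hc : ∀ x ∈ Ω, 0 ≤ c x) {P : E2 × ℝ → ℝ} (hP : ContDiff ℝ (⊤ : ℕ∞) P)
    (hpde : ∀ x ∈ Ω, ∀ t, 0 < t → t ≤ T → 0 ≤ DD tt P (x, t) - LL k P (x, t) + c x * P (x, t))
    (hic : ∀ x ∈ Ω, 0 ≤ P (x, 0))
    (hrobin : ∀ x ∈ frontier Ω, ∀ ν : E2, ‖ν‖ = 1 →
      (∀ y ∈ closure Ω, (inner ℝ ν (y - x) : ℝ) ≤ 0) → ∀ t, 0 < t → t ≤ T →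
      k x * DD (ν, (0:ℝ)) P (x, t) + μ x * P (x, t) = 0) :
    ∀ x ∈ Ω, ∀ t, 0 ≤ t → t ≤ T → 0 ≤ P (x, t) := by
  intro x0 hx0 t0 ht0 ht0T
  obtain ⟨M, hM0, hM⟩ := div_bound hΩo hΩb hΩconv hkC1 hx0
  set l := M + 1 with hl
  have hBs := BB_smooth l x0
  have hBpos : ∀ z, 0 < BB l x0 z := fun z => by unfold BB; positivity
  -- main claim
  have key : ∀ ε > 0, 0 ≤ P (x0, t0) + ε * BB l x0 (x0, t0) := by
    intro ε hε
    set G : E2 × ℝ → ℝ := fun z => ε * BB l x0 z with hG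
    have hGs : ContDiff ℝ (⊤ : ℕ∞) G := contDiff_const.mul hBs
    have hDG : ∀ (a : E2 × ℝ) (F : E2 × ℝ → ℝ), ContDiff ℝ (⊤ : ℕ∞) F →
        DD a (fun z => ε * F z) = fun z => ε * DD a F z := by
      intro a F hF
      funext z
      unfold DD
      rw [fderiv_const_mul (smooth_diff hF z)]; rfl
    have hLG : ∀ z, LL k G z = ε * LL k (BB l x0) z := by
      intro z
      unfold LL
      rw [Finset.mul_sum]
      refine Finset.sum_congr rfl fun i _ => ?_
      rw [hG, hDG _ _ hBs, hDG _ _ (DD_smooth _ hBs)]; ring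
    set q : E2 × ℝ → ℝ := fun z => P z + G z with hq
    have hqs : ContDiff ℝ (⊤ : ℕ∞) q := hP.add hGs
    set S : Set (E2 × ℝ) := closure Ω ×ˢ Set.Icc 0 T with hS
    have hSconv : Convex ℝ S := hΩconv.closure.prod (convex_Icc 0 T)
    have hScomp : IsCompact S := hΩb.isCompact_closure.prod isCompact_Icc
    obtain ⟨⟨x, t⟩, hzS, hmin⟩ := hScomp.exists_isMinOn
      ⟨(x0, t0), subset_closure hx0, ht0, ht0T⟩ hqs.continuous.continuousOn
    have hmem0 : (x0, t0) ∈ S := ⟨subset_closure hx0, ht0, ht0T⟩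
    change 0 ≤ q (x0, t0)
    by_contra hneg
    push Not at hneg
    have hqneg : q (x, t) < 0 := lt_of_le_of_lt (hmin hmem0) hneg
    obtain ⟨hxc, htl, htu⟩ := hzS
    simp only at hxc htl htu
    have hPneg : P (x, t) < 0 := by
      have := mul_pos hε (hBpos (x, t))
      simp only [hq, hG] at hqneg
      linarith
    -- t > 0
    have htpos : 0 < t := by
      rcases htl.lt_or_eq with h | h
      · exact h
      · exfalso
        have hcl : closure Ω ⊆ {y | 0 ≤ P (y, 0)} :=
          closure_minimal (fun y hy => hic y hy) (isClosed_le continuous_const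
            (hP.continuous.comp (by fun_prop)))
        have := hcl hxc
        simp only [Set.mem_ofPred_eq] at this
        rw [← h] at hPneg
        linarith
    have hfo : ∀ y ∈ S, 0 ≤ DD (y - (x, t)) q (x, t) := fun y hy =>
      first_order hSconv hqs ⟨hxc, htl, htu⟩ hmin hy
    by_cases hxΩ : x ∈ Ω
    · -- interior
      have h1 : DD tt q (x, t) ≤ 0 := by
        have := hfo (x, 0) ⟨hxc, le_rfl, hT.le⟩
        have he : ((x, (0:ℝ)) - (x, t) : E2 × ℝ) = (-t) • tt := by ext <;> simp
        rw [he] at this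
        unfold DD at this ⊢
        rw [map_smul, smul_eq_mul] at this
        nlinarith
      have hloc : ∀ᶠ y in nhds x, q (x, t) ≤ q (y, t) := by
        filter_upwards [hΩo.mem_nhds hxΩ] with y hy
        exact hmin (show (y, t) ∈ S from ⟨subset_closure hy, htl, htu⟩)
      have hl1 : ∀ i, IsLocalMin (fun s : ℝ => q ((x, t) + s • ee i)) 0 := by
        intro i
        have hten : Filter.Tendsto (fun s : ℝ => x + s • (EuclideanSpace.single i (1:ℝ) : E2)) (nhds 0) (nhds x) := by
          have : Continuous (fun s : ℝ => x + s • (EuclideanSpace.single i (1:ℝ) : E2)) := by fun_prop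
          simpa using this.tendsto 0
        filter_upwards [hten.eventually hloc] with s hs
        simpa using hs
      have h2 : ∀ i, 0 ≤ DD (ee i) (DD (ee i) q) (x, t) := fun i => second_nonneg _ hqs _ (hl1 i)
      have h3 : ∀ i, DD (ee i) q (x, t) = 0 := by
        intro i
        have := (hl1 i).hasDerivAt_eq_zero (DD_line (ee i) hqs (x, t) 0)
        simpa using this
      have hk : 0 < k x := lt_of_lt_of_le hk₁ (hkbd x hxc)
      have h4 : 0 ≤ LL k q (x, t) := by
        unfold LL
        refine Finset.sum_nonneg fun i _ => ?_
        rw [h3 i]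
        have := mul_nonneg hk.le (h2 i)
        simpa using this
      have h5 : DD tt q (x, t) = DD tt P (x, t) + ε * (l * BB l x0 (x, t)) := by
        rw [hq, DD_add _ hP hGs, hG, hDG _ _ hBs]; simp only [BB_time]
      have h6 : LL k q (x, t) = LL k P (x, t) + ε * LL k (BB l x0) (x, t) := by
        rw [hq, LL_add hP hGs, hLG]
      have h7 := hpde x hxΩ t htpos htu
      have h8 := mul_nonneg (hc x hxΩ) (neg_nonneg.2 hPneg.le)
      have h9 : LL k (BB l x0) (x, t) < l * BB l x0 (x, t) := by
        rw [LL_BB]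
        unfold BB
        simp only
        have he := Real.exp_pos (l * t)
        have h10 := hM x hxΩ
        have h11 : 2 * k x + fderiv ℝ k x (x - x0) < l * (1 + ‖x - x0‖ ^ 2 / 2) := by
          have : 0 ≤ l * (‖x - x0‖ ^ 2 / 2) := by positivity
          linarith
        have := mul_lt_mul_of_pos_left h11 he
        linarith
      have h12 := mul_lt_mul_of_pos_left h9 hε
      linarith
    · -- boundary
      have hxf : x ∈ frontier Ω := by
        rw [frontier, hΩo.interior_eq]; exact ⟨hxc, hxΩ⟩
      have hk : 0 < k x := lt_of_lt_of_le hk₁ (hkbd x hxc)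
      obtain ⟨ν, hν, hνn, hd⟩ : ∃ ν : E2, ‖ν‖ = 1 ∧
          (∀ y ∈ closure Ω, (inner ℝ ν (y - x) : ℝ) ≤ 0) ∧ DD (ν, (0:ℝ)) q (x, t) ≤ 0 := by
        set φ : E2 →L[ℝ] ℝ := (fderiv ℝ q (x, t)).comp (ContinuousLinearMap.inl ℝ E2 ℝ) with hφ
        have hφe : ∀ e, DD (e, (0:ℝ)) q (x, t) = φ e := fun e => by simp [hφ, DD]
        set g := (InnerProductSpace.toDual ℝ E2).symm φ with hg
        have hgi : ∀ y, inner ℝ g y = φ y := fun y => by simp [hg]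
        have hge : ∀ y ∈ closure Ω, 0 ≤ φ (y - x) := by
          intro y hy
          have := hfo (y, t) ⟨hy, htl, htu⟩
          rw [← hφe]
          simpa using this
        by_cases hg0 : g = 0
        · obtain ⟨ν, hν, hνn⟩ := exists_normal hΩo hΩconv ⟨x0, hx0⟩ hxΩ
          refine ⟨ν, hν, hνn, ?_⟩
          rw [hφe, ← hgi, hg0]; simp
        · refine ⟨-(‖g‖⁻¹ • g), by rw [norm_neg, norm_smul]; simp [hg0], ?_, ?_⟩
          · intro y hy
            rw [inner_neg_left, real_inner_smul_left, hgi]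
            have := mul_nonneg (inv_nonneg.2 (norm_nonneg g)) (hge y hy)
            linarith
          · rw [hφe, ← hgi, inner_neg_right, real_inner_smul_right, real_inner_self_eq_norm_sq]
            have : 0 ≤ ‖g‖⁻¹ * ‖g‖ ^ 2 := by positivity
            linarith
      have h1 := hrobin x hxf ν hν hνn t htpos htu
      have h2 : DD (ν, (0:ℝ)) q (x, t) = DD (ν, (0:ℝ)) P (x, t) +
          ε * (Real.exp (l * t) * inner ℝ ν (x - x0)) := by
        rw [hq, DD_add _ hP hGs, hG, hDG _ _ hBs, BB_space]
      have h3 := normal_pos hΩo hx0 hν hνn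
      have h4 : 0 < ε * (Real.exp (l * t) * inner ℝ ν (x - x0)) := by positivity
      have h5 := mul_nonneg (hμ x hxf) (neg_nonneg.2 hPneg.le)
      have h6 : 0 < k x * (- DD (ν, (0:ℝ)) P (x, t)) := mul_pos hk (by linarith)
      linarith
  have hb := hBpos (x0, t0)
  by_contra hneg
  push Not at hneg
  have := key (- P (x0, t0) / (2 * BB l x0 (x0, t0))) (by apply div_pos <;> linarith)
  have h2 : - P (x0, t0) / (2 * BB l x0 (x0, t0)) * BB l x0 (x0, t0) = - P (x0, t0) / 2 := by
    field_simp
  linarith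

lemma deriv_zero_of_Ioc {T : ℝ} {g : ℝ → ℝ} {g' t : ℝ} (hg : HasDerivAt g g' t)
    (h : ∀ s, 0 < s → s ≤ T → g s = 0) (ht : 0 < t) (htT : t ≤ T) : g' = 0 := by
  have hu : UniqueDiffWithinAt ℝ (Set.Ioc 0 T) t := uniqueDiffOn_Ioc 0 T t ⟨ht, htT⟩
  have h0 : HasDerivWithinAt g 0 (Set.Ioc 0 T) t :=
    (hasDerivWithinAt_const t _ (0:ℝ)).congr (fun s hs => h s hs.1 hs.2) (h t ht htT)
  exact hu.eq_deriv _ hg.hasDerivWithinAt h0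

lemma k_diff {Ω : Set E2} (hΩo : IsOpen Ω) {k : E2 → ℝ} (hkC1 : ContDiffOn ℝ 1 k (closure Ω))
    {x : E2} (hx : x ∈ Ω) : DifferentiableAt ℝ k x :=
  (hkC1.contDiffAt (Filter.mem_of_superset (hΩo.mem_nhds hx) subset_closure)).differentiableAt
    (by simp)

lemma sol_pde {Ω : Set E2} (hΩo : IsOpen Ω) {T : ℝ} {k μ : E2 → ℝ}
    (hkC1 : ContDiffOn ℝ 1 k (closure Ω)) {c : E2 → ℝ} {f u : E2 → ℝ → ℝ}
    (hureg : ContDiff ℝ (⊤ : ℕ∞) (Function.uncurry u)) (hu : IsDirectSolution Ω T k μ c f u)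
    {x : E2} (hx : x ∈ Ω) {t : ℝ} (ht : 0 < t) (htT : t ≤ T) :
    DD tt (Function.uncurry u) (x, t) - LL k (Function.uncurry u) (x, t)
      + c x * Function.uncurry u (x, t) - Function.uncurry f (x, t) = 0 := by
  have h := hu.pde x hx t ht htT
  have h1 : deriv (u x) t = DD tt (Function.uncurry u) (x, t) := (DD_time hureg x t).deriv
  have h2 := ellOp_eq hureg x t (k_diff hΩo hkC1 hx)
  simp only [Function.uncurry_apply_pair] at h2 ⊢
  rw [h1, h2] at h
  linarith

lemma sol_dt {Ω : Set E2} (hΩo : IsOpen Ω) {T : ℝ} (hT : 0 < T) {k μ : E2 → ℝ}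
    (hkC1 : ContDiffOn ℝ 1 k (closure Ω)) {c : E2 → ℝ} {f u : E2 → ℝ → ℝ}
    (hf : ContDiff ℝ (⊤ : ℕ∞) (Function.uncurry f)) (hf0 : ∀ x ∈ Ω, f x 0 = 0)
    (hureg : ContDiff ℝ (⊤ : ℕ∞) (Function.uncurry u)) (hu : IsDirectSolution Ω T k μ c f u) :
    (∀ x ∈ Ω, ∀ t, 0 < t → t ≤ T → DD tt (DD tt (Function.uncurry u)) (x, t)
      - LL k (DD tt (Function.uncurry u)) (x, t) + c x * DD tt (Function.uncurry u) (x, t)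
      = DD tt (Function.uncurry f) (x, t)) ∧
    (∀ x ∈ Ω, DD tt (Function.uncurry u) (x, 0) = 0) ∧
    (∀ x ∈ frontier Ω, ∀ ν : E2, ‖ν‖ = 1 →
      (∀ y ∈ closure Ω, (inner ℝ ν (y - x) : ℝ) ≤ 0) → ∀ t, 0 < t → t ≤ T →
      k x * DD (ν, (0:ℝ)) (DD tt (Function.uncurry u)) (x, t)
        + μ x * DD tt (Function.uncurry u) (x, t) = 0) := by
  set U := Function.uncurry u with hU
  have hPs := DD_smooth tt hureg
  have hder : ∀ x t, HasDerivAt (fun s => DD tt U (x, s) - LL k U (x, s) + c x * U (x, s)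
      - Function.uncurry f (x, s)) (DD tt (DD tt U) (x, t) - LL k (DD tt U) (x, t)
      + c x * DD tt U (x, t) - DD tt (Function.uncurry f) (x, t)) t := fun x t =>
    (((DD_time hPs x t).sub (LL_time hureg x t)).add ((DD_time hureg x t).const_mul (c x))).sub
      (DD_time hf x t)
  refine ⟨?_, ?_, ?_⟩
  · intro x hx t ht htT
    have := deriv_zero_of_Ioc (hder x t) (fun s hs hsT => sol_pde hΩo hkC1 hureg hu hx hs hsT) ht htT
    linarith
  · intro x hx
    have h1 : Filter.Tendsto (fun s => DD tt U (x, s) - LL k U (x, s) + c x * U (x, s)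
      - Function.uncurry f (x, s)) (nhdsWithin 0 (Set.Ioi 0)) (nhds _) :=
      (hder x 0).continuousAt.tendsto.mono_left nhdsWithin_le_nhds
    have h2 : Filter.Tendsto (fun s => DD tt U (x, s) - LL k U (x, s) + c x * U (x, s)
      - Function.uncurry f (x, s)) (nhdsWithin 0 (Set.Ioi 0)) (nhds 0) := by
      refine tendsto_const_nhds.congr' ?_
      filter_upwards [Ioc_mem_nhdsGT hT] with s hs
      exact (sol_pde hΩo hkC1 hureg hu hx hs.1 hs.2).symm
    have h3 := tendsto_nhds_unique h1 h2
    have h4 : U (x, 0) = 0 := hu.ic x hx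
    have h5 : Function.uncurry f (x, 0) = 0 := hf0 x hx
    have h6 : LL k U (x, 0) = 0 := by
      have hz : ∀ (F : E2 × ℝ → ℝ), ContDiff ℝ (⊤ : ℕ∞) F → (∀ y ∈ Ω, F (y, 0) = 0) →
          ∀ (e : E2), ∀ y ∈ Ω, DD (e, (0:ℝ)) F (y, 0) = 0 := by
        intro F hF h0 e y hy
        rw [← DD_space hF]
        have : (fun y => F (y, 0)) =ᶠ[nhds y] fun _ => 0 := by
          filter_upwards [hΩo.mem_nhds hy] with y' hy'
          exact h0 y' hy'
        rw [this.fderiv_eq]; simp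
      have ha := fun e => hz U hureg hu.ic e
      unfold LL
      refine Finset.sum_eq_zero fun i _ => ?_
      rw [ha _ x hx, hz _ (DD_smooth _ hureg) (ha _) _ x hx]; simp
    rw [h4, h5, h6] at h3
    linarith
  · intro x hx ν hν hn t ht htT
    rw [DD_comm _ _ hureg]
    refine deriv_zero_of_Ioc (T := T) (g := fun s => k x * DD (ν, (0:ℝ)) U (x, s) + μ x * U (x, s)) ?_ ?_ ht htT
    · exact ((DD_time (DD_smooth _ hureg) x t).const_mul _).add ((DD_time hureg x t).const_mul _)
    · intro s hs hsT
      have := hu.robin x hx ν hν hn s hs hsT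
      have h2 := DD_space hureg x s ν
      rw [← h2]
      exact this

/-- for the iterative process started from the initial approximation (16),
for every `k ≥ 1`, `wᵏ = uᵏ - uᵏ⁻¹ ≥ 0` on `Ω × (0,T]` and `ξᵏ = cᵏ - cᵏ⁻¹ ≤ 0` on `Ω`. -/
theorem iterates_monotone
    (Ω : Set E2) (hΩo : IsOpen Ω) (hΩb : Bornology.IsBounded Ω) (hΩconv : Convex ℝ Ω)
    (T : ℝ) (hT : 0 < T)
    (k μ : E2 → ℝ) (k₁ k₂ : ℝ) (hk₁ : 0 < k₁)
    (hkbd : ∀ x ∈ closure Ω, k₁ ≤ k x ∧ k x ≤ k₂)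
    (hkC1 : ContDiffOn ℝ 1 k (closure Ω))
    (hμ : ∀ x ∈ frontier Ω, 0 ≤ μ x)
    (f : E2 → ℝ → ℝ) (hf : ContDiff ℝ (⊤ : ℕ∞) (Function.uncurry f))
    (c : E2 → ℝ) (hc : ∀ x ∈ Ω, 0 ≤ c x)
    (u : E2 → ℝ → ℝ) (hureg : ContDiff ℝ (⊤ : ℕ∞) (Function.uncurry u))
    (hu : IsDirectSolution Ω T k μ c f u)
    (hf0 : ∀ x ∈ Ω, f x 0 = 0)
    (hft : ∀ x ∈ Ω, ∀ t : ℝ, 0 ≤ t → t ≤ T → 0 < deriv (f x) t)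
    (ψ : E2 → ℝ) (hψdef : ∀ x, ψ x = u x T) (hψpos : ∀ x ∈ Ω, 0 < ψ x)
    (cs : ℕ → E2 → ℝ) (us : ℕ → E2 → ℝ → ℝ)
    (hsol : ∀ n : ℕ, IsDirectSolution Ω T k μ (cs n) f (us n))
    (hregs : ∀ n : ℕ, ContDiff ℝ (⊤ : ℕ∞) (Function.uncurry (us n)))
    (hiter : ∀ n : ℕ, ∀ x ∈ Ω,
      cs (n + 1) x * ψ x = - deriv (us n x) T - ellOp k ψ x + f x T)
    (hinit : ∀ x ∈ Ω, cs 0 x * ψ x = - ellOp k ψ x + f x T) :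
    ∀ n : ℕ, 1 ≤ n →
      (∀ x ∈ Ω, ∀ t : ℝ, 0 < t → t ≤ T → 0 ≤ us n x t - us (n - 1) x t) ∧
        (∀ x ∈ Ω, cs n x - cs (n - 1) x ≤ 0) := by
  have hkb : ∀ x ∈ closure Ω, k₁ ≤ k x := fun x hx => (hkbd x hx).1
  -- positivity of the time derivative
  have hpos : ∀ (c' : E2 → ℝ) (u' : E2 → ℝ → ℝ), (∀ x ∈ Ω, 0 ≤ c' x) →
      ContDiff ℝ (⊤ : ℕ∞) (Function.uncurry u') → IsDirectSolution Ω T k μ c' f u' →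
      ∀ x ∈ Ω, ∀ t, 0 ≤ t → t ≤ T → 0 ≤ DD tt (Function.uncurry u') (x, t) := by
    intro c' u' hc' hr hs
    obtain ⟨h1, h2, h3⟩ := sol_dt hΩo hT hkC1 hf hf0 hr hs
    refine min_principle hΩo hΩb hΩconv hT hk₁ hkb hkC1 hμ hc' (DD_smooth _ hr) ?_
      (fun x hx => (h2 x hx).ge) h3
    intro x hx t ht htT
    rw [h1 x hx t ht htT]
    have := hft x hx t ht.le htT
    have h4 : deriv (f x) t = DD tt (Function.uncurry f) (x, t) := (DD_time hf x t).deriv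
    linarith
  -- comparison of the time derivatives
  have hcomp : ∀ (a b : E2 → ℝ) (ua ub : E2 → ℝ → ℝ), (∀ x ∈ Ω, 0 ≤ a x) → (∀ x ∈ Ω, a x ≤ b x) →
      ContDiff ℝ (⊤ : ℕ∞) (Function.uncurry ua) → ContDiff ℝ (⊤ : ℕ∞) (Function.uncurry ub) →
      IsDirectSolution Ω T k μ a f ua → IsDirectSolution Ω T k μ b f ub →
      ∀ x ∈ Ω, ∀ t, 0 ≤ t → t ≤ T →
        0 ≤ DD tt (Function.uncurry ua) (x, t) - DD tt (Function.uncurry ub) (x, t) := by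
    intro a b ua ub ha hab hra hrb hsa hsb
    have hvb := hpos b ub (fun x hx => (ha x hx).trans (hab x hx)) hrb hsb
    obtain ⟨a1, a2, a3⟩ := sol_dt hΩo hT hkC1 hf hf0 hra hsa
    obtain ⟨b1, b2, b3⟩ := sol_dt hΩo hT hkC1 hf hf0 hrb hsb
    have hA := DD_smooth tt hra
    have hB := DD_smooth tt hrb
    refine min_principle (P := fun z => DD tt (Function.uncurry ua) z - DD tt (Function.uncurry ub) z)
      hΩo hΩb hΩconv hT hk₁ hkb hkC1 hμ ha (hA.sub hB) ?_ ?_ ?_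
    · intro x hx t ht htT
      rw [DD_sub _ hA hB, LL_sub hA hB]
      have h1 := a1 x hx t ht htT
      have h2 := b1 x hx t ht htT
      have h3 := mul_nonneg (sub_nonneg.2 (hab x hx)) (hvb x hx t ht.le htT)
      simp only
      linarith
    · intro x hx
      rw [a2 x hx, b2 x hx]; simp
    · intro x hx ν hν hn t ht htT
      rw [DD_sub _ hA hB]
      have h1 := a3 x hx ν hν hn t ht htT
      have h2 := b3 x hx ν hν hn t ht htT
      simp only
      linarith
  have hD : ∀ (v : E2 → ℝ → ℝ), ContDiff ℝ (⊤ : ℕ∞) (Function.uncurry v) → ∀ x t,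
      deriv (v x) t = DD tt (Function.uncurry v) (x, t) := fun v hv x t => (DD_time hv x t).deriv
  have hψfun : ψ = fun y => u y T := funext hψdef
  have hcψ : ∀ x ∈ Ω, c x * ψ x = - deriv (u x) T - ellOp k ψ x + f x T := by
    intro x hx
    have := hu.pde x hx T hT le_rfl
    rw [← hψfun, ← hψdef x] at this
    linarith
  -- lower bound of the coefficients
  have hlow : ∀ n, ∀ x ∈ Ω, c x ≤ cs n x := by
    intro n
    induction n with
    | zero =>
      intro x hx
      have h1 := hpos c u hc hureg hu x hx T hT.le le_rfl
      rw [← hD u hureg] at h1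
      refine le_of_mul_le_mul_right ?_ (hψpos x hx)
      rw [hcψ x hx, hinit x hx]; linarith
    | succ n ih =>
      intro x hx
      have h1 := hcomp c (cs n) u (us n) hc ih hureg (hregs n) hu (hsol n) x hx T hT.le le_rfl
      rw [← hD u hureg, ← hD _ (hregs n)] at h1
      refine le_of_mul_le_mul_right ?_ (hψpos x hx)
      rw [hcψ x hx, hiter n x hx]; linarith
  have hcs0 : ∀ n, ∀ x ∈ Ω, 0 ≤ cs n x := fun n x hx => (hc x hx).trans (hlow n x hx)
  have hdec : ∀ n, ∀ x ∈ Ω, cs (n + 1) x ≤ cs n x := by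
    intro n
    induction n with
    | zero =>
      intro x hx
      have h1 := hpos (cs 0) (us 0) (hcs0 0) (hregs 0) (hsol 0) x hx T hT.le le_rfl
      rw [← hD _ (hregs 0)] at h1
      refine le_of_mul_le_mul_right ?_ (hψpos x hx)
      rw [hiter 0 x hx, hinit x hx]; linarith
    | succ n ih =>
      intro x hx
      have h1 := hcomp (cs (n+1)) (cs n) (us (n+1)) (us n) (hcs0 _) ih (hregs _) (hregs _)
        (hsol _) (hsol _) x hx T hT.le le_rfl
      rw [← hD _ (hregs _), ← hD _ (hregs _)] at h1
      refine le_of_mul_le_mul_right ?_ (hψpos x hx)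
      rw [hiter (n+1) x hx, hiter n x hx]; linarith
  intro n hn
  obtain ⟨m, rfl⟩ : ∃ m, n = m + 1 := ⟨n - 1, by omega⟩
  simp only [Nat.add_sub_cancel]
  refine ⟨?_, fun x hx => sub_nonpos.2 (hdec m x hx)⟩
  intro x hx t ht htT
  have h1 := hcomp (cs (m+1)) (cs m) (us (m+1)) (us m) (hcs0 _) (hdec m) (hregs _) (hregs _)
        (hsol _) (hsol _) x hx
  have hder : ∀ s, HasDerivAt (fun s => us (m+1) x s - us m x s)
      (DD tt (Function.uncurry (us (m+1))) (x, s) - DD tt (Function.uncurry (us m)) (x, s)) s :=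
    fun s => (DD_time (hregs (m+1)) x s).sub (DD_time (hregs m) x s)
  have hmono : MonotoneOn (fun s => us (m+1) x s - us m x s) (Set.Icc 0 T) := by
    refine monotoneOn_of_deriv_nonneg (convex_Icc 0 T)
      (fun s _ => (hder s).continuousAt.continuousWithinAt)
      (fun s _ => (hder s).differentiableAt.differentiableWithinAt) ?_
    intro s hs
    rw [interior_Icc] at hs
    rw [(hder s).deriv]
    exact h1 s hs.1.le hs.2.le
  have h2 := hmono ⟨le_rfl, hT.le⟩ ⟨ht.le, htT⟩ ht.le
  simp only [(hsol (m+1)).ic x hx, (hsol m).ic x hx] at h2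
  linarith

end
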